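/- arXiv:1502.00363 — 2 statements merged into one kernel-verified Lean document; each statement's English description precedes it below -/
import Mathlib

section
/- Weak duality for NCML: let (x_p, y_p), p = 1, ..., n, be pairs of vectors in ℝ^d, X_p = (x_p − y_p)(x_p − y_p)ᵀ, K the n×n Gram matrix with K_{pq} = ⟨X_p, X_q⟩, h_p ∈ {−1, 1}, and C > 0. Suppose (α, b, ξ) is primal feasible: for all p, h_p(Σ_q α_q K_{pq} + b) ≥ 1 − ξ_p, α_p ≥ 0, and ξ_p ≥ 0. Suppose (η, β) is dual feasible: Σ_q η_q K_{pq} ≥ 0 for all p, 0 ≤ β_p ≤ C for all p, and Σ_p β_p h_p = 0. Then −(1/2) Σ_p Σ_q (β_p h_p + η_p)(β_q h_q + η_q) K_{pq} + Σ_p β_p ≤ (1/2) Σ_p Σ_q α_p α_q K_{pq} + C Σ_p ξ_p. -/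
open Matrix BigOperators

/-- The Frobenius inner product `⟨A, B⟩ = tr(Aᵀ B)` of two real `d × d` matrices. -/
def frob {d : ℕ} (A B : Matrix (Fin d) (Fin d) ℝ) : ℝ :=
  (Aᵀ * B).trace

/-- The Frobenius inner product is symmetric. -/
theorem frob_comm {d : ℕ} (A B : Matrix (Fin d) (Fin d) ℝ) : frob A B = frob B A := by
  unfold frob
  rw [← Matrix.trace_transpose, Matrix.transpose_mul, Matrix.transpose_transpose]

theorem frob_self_nonneg {d : ℕ} (A : Matrix (Fin d) (Fin d) ℝ) : 0 ≤ frob A A := by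
  simp only [frob, Matrix.trace, Matrix.diag, Matrix.mul_apply, Matrix.transpose_apply]
  exact Finset.sum_nonneg fun i _ => Finset.sum_nonneg fun j _ => mul_self_nonneg _

/-- A Gram matrix for the Frobenius inner product is positive semidefinite. -/
theorem sum_sum_mul_frob_nonneg {ι : Type*} [Fintype ι] {d : ℕ}
    (X : ι → Matrix (Fin d) (Fin d) ℝ) (v : ι → ℝ) :
    0 ≤ ∑ p, ∑ q, v p * v q * frob (X p) (X q) := by
  have h : frob (∑ p, v p • X p) (∑ q, v q • X q)
      = ∑ p, ∑ q, v p * v q * frob (X p) (X q) := by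
    simp only [frob, Matrix.transpose_sum, Matrix.transpose_smul, Finset.sum_mul,
      Finset.mul_sum, Matrix.trace_sum, Matrix.smul_mul, Matrix.mul_smul, Matrix.trace_smul,
      smul_eq_mul, mul_assoc]
    exact Finset.sum_congr rfl fun p _ => Finset.sum_congr rfl fun q _ =>
      congrArg (fun t => v p * (v q * t)) (frob_comm (X q) (X p))
  exact h ▸ frob_self_nonneg _

/-- weak duality for NCML.  With `X_p = (x_p − y_p)(x_p − y_p)ᵀ`
and Gram matrix `K_{pq} = ⟨X_p, X_q⟩`, every dual-feasible objective value is at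
most every primal-feasible objective value. -/
theorem ncml_weak_duality
    (d n : ℕ) (x y : Fin n → (Fin d → ℝ))
    (X : Fin n → Matrix (Fin d) (Fin d) ℝ)
    (hX : ∀ p, X p = Matrix.vecMulVec (x p - y p) (x p - y p))
    (K : Matrix (Fin n) (Fin n) ℝ)
    (hK : ∀ p q, K p q = frob (X p) (X q))
    (h : Fin n → ℝ) (hh : ∀ p, h p = 1 ∨ h p = -1)
    (C : ℝ) (hC : 0 < C)
    -- primal feasibility
    (α : Fin n → ℝ) (b : ℝ) (ξ : Fin n → ℝ)
    (hfeas : ∀ p, h p * ((∑ q, α q * K p q) + b) ≥ 1 - ξ p)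
    (hα : ∀ p, 0 ≤ α p) (hξ : ∀ p, 0 ≤ ξ p)
    -- dual feasibility
    (η β : Fin n → ℝ)
    (hη : ∀ p, 0 ≤ ∑ q, η q * K p q)
    (hβ : ∀ p, 0 ≤ β p ∧ β p ≤ C)
    (hβh : ∑ p, β p * h p = 0) :
    -(1/2) * (∑ p, ∑ q, (β p * h p + η p) * (β q * h q + η q) * K p q) + ∑ p, β p
      ≤ (1/2) * (∑ p, ∑ q, α p * α q * K p q) + C * ∑ p, ξ p := by
  have hsymm : ∀ p q, K p q = K q p := fun p q => by rw [hK, hK, frob_comm]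
  have hcomm (u v : Fin n → ℝ) :
      ∑ p, ∑ q, u p * v q * K p q = ∑ p, ∑ q, v p * u q * K p q := by
    rw [Finset.sum_comm]
    refine Finset.sum_congr rfl fun p _ => Finset.sum_congr rfl fun q _ => ?_
    rw [hsymm q p]
    ring
  have hpsd : 0 ≤ ∑ p, ∑ q,
      (β p * h p + η p - α p) * (β q * h q + η q - α q) * K p q := by
    simpa only [hK] using sum_sum_mul_frob_nonneg X fun p => β p * h p + η p - α p
  have hexpand : ∑ p, ∑ q, (β p * h p + η p - α p) * (β q * h q + η q - α q) * K p q
      = ∑ p, ∑ q, (β p * h p + η p) * (β q * h q + η q) * K p q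
        - ∑ p, ∑ q, (β p * h p + η p) * α q * K p q
        - ∑ p, ∑ q, α p * (β q * h q + η q) * K p q
        + ∑ p, ∑ q, α p * α q * K p q := by
    simp only [← Finset.sum_sub_distrib, ← Finset.sum_add_distrib]
    refine Finset.sum_congr rfl fun p _ => Finset.sum_congr rfl fun q _ => ?_
    ring
  have hcross := hcomm (fun p => β p * h p + η p) α
  have hsplit : ∑ p, ∑ q, (β p * h p + η p) * α q * K p q
      = ∑ p, ∑ q, β p * h p * α q * K p q + ∑ p, ∑ q, η p * α q * K p q := by
    simp only [← Finset.sum_add_distrib, add_mul]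
  have hηα : 0 ≤ ∑ p, ∑ q, η p * α q * K p q := by
    rw [hcomm η α]
    refine Finset.sum_nonneg fun p _ => ?_
    simp only [mul_assoc, ← Finset.mul_sum]
    exact mul_nonneg (hα p) (hη p)
  have hslack : ∑ p, β p ≤ C * ∑ p, ξ p + ∑ p, ∑ q, β p * h p * α q * K p q
      + b * ∑ p, β p * h p := by
    simp only [Finset.mul_sum, ← Finset.sum_add_distrib]
    refine Finset.sum_le_sum fun p _ => ?_
    have hsum : ∑ q, β p * h p * α q * K p q = β p * h p * ∑ q, α q * K p q := by
      simp only [Finset.mul_sum, mul_assoc]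
    rw [hsum]
    linarith [mul_le_mul_of_nonneg_left (hfeas p) (hβ p).1,
      mul_le_mul_of_nonneg_right (hβ p).2 (hξ p)]
  rw [hβh] at hslack
  linarith
end

section
/- Nonnegativity of the PCML duality gap at a KKT point: under the PCML KKT conditions — M = Σ_p λ_p h_p X_p + Y with Y symmetric positive semidefinite, M symmetric positive semidefinite, Σ_p λ_p h_p = 0, 0 ≤ λ_p ≤ C, λ_p(h_p(⟨M, X_p⟩ + b) − 1 + ξ_p) = 0, and (C − λ_p)ξ_p = 0 for all p — the duality gap (1/2)‖M‖_F² + C Σ_p ξ_p − (−(1/2)‖Σ_p λ_p h_p X_p + Y‖_F² + Σ_p λ_p) is nonnegative, and it is zero if and only if ⟨M, Y⟩ = 0. -/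
open Matrix BigOperators

open scoped MatrixOrder in
theorem frob_nonneg {d : ℕ} {A B : Matrix (Fin d) (Fin d) ℝ}
    (hA : A.PosSemidef) (hB : B.PosSemidef) : 0 ≤ frob A B := by
  obtain ⟨D, rfl⟩ := CStarAlgebra.nonneg_iff_eq_star_mul_self.mp hB.nonneg
  have hD := (hA.transpose.mul_mul_conjTranspose_same D).trace_nonneg
  rwa [Matrix.mul_assoc, Matrix.trace_mul_comm, Matrix.mul_assoc] at hD

theorem frob_sum_smul_add {d : ℕ} {P : Type*} [Fintype P] (A B : Matrix (Fin d) (Fin d) ℝ)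
    (c : P → ℝ) (X : P → Matrix (Fin d) (Fin d) ℝ) :
    frob A (∑ p, c p • X p + B) = ∑ p, c p * frob A (X p) + frob A B := by
  simp [frob, Matrix.mul_add, Matrix.mul_sum, Matrix.trace_sum]

/-- nonnegativity of the PCML duality gap at a KKT point.  Under
the PCML KKT conditions, the duality gap is nonnegative, and it is zero if and
only if `⟨M, Y⟩ = 0`. -/
theorem pcml_duality_gap_nonneg
    {d : ℕ} {P : Type*} [Fintype P]
    (h : P → ℝ) (hh : ∀ p, h p = 1 ∨ h p = -1)
    (X : P → Matrix (Fin d) (Fin d) ℝ) (hXsymm : ∀ p, (X p).IsSymm)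
    (C : ℝ) (hC : 0 < C)
    (M Y : Matrix (Fin d) (Fin d) ℝ)
    (hMpsd : M.PosSemidef) (hYpsd : Y.PosSemidef)
    (b : ℝ) (lam ξ : P → ℝ)
    (hstat : M = ∑ p, (lam p * h p) • X p + Y)
    (hsum : ∑ p, lam p * h p = 0)
    (hbox : ∀ p, 0 ≤ lam p ∧ lam p ≤ C)
    (hcs1 : ∀ p, lam p * (h p * (frob M (X p) + b) - 1 + ξ p) = 0)
    (hcs2 : ∀ p, (C - lam p) * ξ p = 0) :
    0 ≤ ((1/2) * frob M M + C * ∑ p, ξ p)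
          - (-(1/2) * frob (∑ p, (lam p * h p) • X p + Y) (∑ p, (lam p * h p) • X p + Y)
              + ∑ p, lam p) ∧
      (((1/2) * frob M M + C * ∑ p, ξ p)
          - (-(1/2) * frob (∑ p, (lam p * h p) • X p + Y) (∑ p, (lam p * h p) • X p + Y)
              + ∑ p, lam p) = 0 ↔ frob M Y = 0) := by
  have hMM : frob M M = ∑ p, (lam p * h p) * frob M (X p) + frob M Y := by
    rw [← frob_sum_smul_add, ← hstat]
  have hslack : ∑ p, (lam p * h p) * frob M (X p) + C * ∑ p, ξ p - ∑ p, lam p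
      + (∑ p, lam p * h p) * b = 0 := by
    rw [Finset.mul_sum, Finset.sum_mul, ← Finset.sum_add_distrib, ← Finset.sum_sub_distrib,
      ← Finset.sum_add_distrib]
    exact Finset.sum_eq_zero fun p _ => by linear_combination hcs1 p + hcs2 p
  rw [hsum] at hslack
  have hgap : ((1/2) * frob M M + C * ∑ p, ξ p) - (-(1/2) * frob M M + ∑ p, lam p)
      = frob M Y := by
    linear_combination hMM + hslack
  rw [← hstat, hgap]
  exact ⟨frob_nonneg hMpsd hYpsd, Iff.rfl⟩
end
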